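/- arXiv:1410.4306 — 6 statements merged into one kernel-verified Lean document; each statement's English description precedes it below -/
import Mathlib

section
/- Pliss Lemma: For every K > 0 and every pair of real numbers γ₁ < γ₂ there exists a constant c > 0 (depending only on K, γ₁, γ₂) with the following property: for every n ≥ 1 and every finite sequence of real numbers a₀, …, a_{n−1} with |a_i| ≤ K for all 0 ≤ i ≤ n−1 and (1/n)·∑_{i=0}^{n−1} a_i < γ₁, there exist indices 0 ≤ n₁ < n₂ < … < n_j ≤ n−1 with j ≥ c·n such that for every 1 ≤ m ≤ j and every 1 ≤ k ≤ n − n_m one has (1/k)·∑_{i=n_m}^{n_m+k−1} a_i < γ₂. -/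
open Classical in
/-- If `S` decreases by at most `C` at each step before time `n`, its total decrease from `p` to
`n` is at most `C` times the number of times `m ∈ [p, n)` after which `S` stays below `S m`. -/
theorem sub_le_mul_card_strict_records (S : ℕ → ℝ) (C : ℝ) (hC : 0 ≤ C) (n : ℕ)
    (hS : ∀ m < n, S m - S (m + 1) ≤ C) (p : ℕ) (hp : p ≤ n) :
    S p - S n ≤
      C * ({m ∈ Finset.Ico p n | ∀ l, m < l → l ≤ n → S l < S m} : Finset ℕ).card := by
  induction hd : n - p using Nat.strong_induction_on generalizing p with
  | _ d ih =>
    obtain rfl | hpn := hp.eq_or_lt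
    · simp
    by_cases hrec : ∀ l, p < l → l ≤ n → S l < S p
    · have hstep := ih (n - (p + 1)) (by omega) (p + 1) hpn rfl
      rw [← Finset.insert_Ico_add_one_left_eq_Ico hpn, Finset.filter_insert, if_pos hrec,
        Finset.card_insert_of_notMem (by simp)]
      push_cast
      linarith [hS p hpn]
    · push Not at hrec
      obtain ⟨l, hpl, hln, hl⟩ := hrec
      calc S p - S n ≤ S l - S n := by linarith
        _ ≤ _ := ih (n - l) (by omega) l hln rfl
        _ ≤ _ := by gcongr


/-- **Pliss Lemma.** For every `K > 0` and `γ₁ < γ₂` there is `c > 0`, depending only on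
`K, γ₁, γ₂`, such that for every `n ≥ 1` and every sequence `a₀, …, a_{n-1}` with `|aᵢ| ≤ K`
and total average below `γ₁`, there are at least `c·n` indices `0 ≤ n₁ < … < n_j ≤ n-1`
from which all forward averages (within the sequence) are below `γ₂`. -/
theorem pliss_lemma (K : ℝ) (hK : 0 < K) (γ₁ γ₂ : ℝ) (hγ : γ₁ < γ₂) :
    ∃ c : ℝ, 0 < c ∧
      ∀ (n : ℕ), 1 ≤ n → ∀ a : ℕ → ℝ,
        (∀ i, i ≤ n - 1 → |a i| ≤ K) →
        (1 / (n : ℝ)) * ∑ i ∈ Finset.range n, a i < γ₁ →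
        ∃ (j : ℕ) (ns : Fin j → ℕ),
          StrictMono ns ∧
          (∀ m : Fin j, ns m ≤ n - 1) ∧
          c * (n : ℝ) ≤ (j : ℝ) ∧
          ∀ (m : Fin j) (k : ℕ), 1 ≤ k → k ≤ n - ns m →
            (1 / (k : ℝ)) * ∑ i ∈ Finset.Ico (ns m) (ns m + k), a i < γ₂ := by
  classical
  have hC : 0 < K + |γ₂| := by positivity
  refine ⟨(γ₂ - γ₁) / (K + |γ₂|), div_pos (sub_pos.2 hγ) hC, fun n hn a ha hsum => ?_⟩
  let S : ℕ → ℝ := fun m => ∑ i ∈ Finset.range m, (a i - γ₂)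
  let P : Finset ℕ := {m ∈ Finset.Ico 0 n | ∀ l, m < l → l ≤ n → S l < S m}
  have hn0 : (0 : ℝ) < n := by exact_mod_cast hn
  have hcard : S 0 - S n ≤ (K + |γ₂|) * P.card := by
    refine sub_le_mul_card_strict_records S _ hC.le n (fun m hm => ?_) 0 n.zero_le
    simp only [S, Finset.sum_range_succ]
    linarith [neg_le_of_abs_le (ha m (by omega)), le_abs_self γ₂]
  have hSn : S n < n * (γ₁ - γ₂) := by
    rw [one_div, inv_mul_lt_iff₀ hn0] at hsum
    simp only [S, Finset.sum_sub_distrib, Finset.sum_const, Finset.card_range, nsmul_eq_mul]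
    linarith
  have hmem (m : Fin P.card) := Finset.mem_filter.1 (P.orderEmbOfFin_mem rfl m)
  refine ⟨P.card, P.orderEmbOfFin rfl, (P.orderEmbOfFin rfl).strictMono, fun m => ?_, ?_,
    fun m k hk hkn => ?_⟩
  · have := Finset.mem_Ico.1 (hmem m).1
    omega
  · rw [div_mul_eq_mul_div, div_le_iff₀ hC]
    have hS0 : S 0 = 0 := Finset.sum_range_zero _
    linarith
  · have hlt := (Finset.mem_Ico.1 (hmem m).1).2
    have hrec := (hmem m).2 (P.orderEmbOfFin rfl m + k) (by omega) (by omega)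
    have hk0 : (0 : ℝ) < k := by exact_mod_cast hk
    rw [one_div, inv_mul_lt_iff₀ hk0]
    have hIco := Finset.sum_Ico_eq_sub (fun i => a i - γ₂)
      (Nat.le_add_right (P.orderEmbOfFin rfl m) k)
    simp only [Finset.sum_sub_distrib (s := Finset.Ico _ _), Finset.sum_const, Nat.card_Ico,
      add_tsub_cancel_left, nsmul_eq_mul] at hIco
    linarith
end

section
/- Let X be a compact metric space, f : X → X a continuous map, and φ : X → ℝ a continuous function. If there exists a point x ∈ X such that liminf_{n→∞} (1/n)·∑_{i=0}^{n−1} φ(f^i(x)) < 0, then there exists a point y ∈ X such that limsup_{n→∞} (1/n)·∑_{i=0}^{n−1} φ(f^i(y)) < 0. -/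
open Filter

theorem continuous_birkhoffSum {X : Type*} [TopologicalSpace X] {f : X → X}
    (hf : Continuous f) {φ : X → ℝ} (hφ : Continuous φ) (n : ℕ) :
    Continuous (birkhoffSum f φ n) :=
  continuous_finsetSum _ fun i _ => hφ.comp (hf.iterate i)

theorem abs_birkhoffSum_le {X : Type*} (f : X → X) {φ : X → ℝ} {M : ℝ}
    (hM : ∀ x, |φ x| ≤ M) (n : ℕ) (x : X) : |birkhoffSum f φ n x| ≤ n * M := by
  refine (Finset.abs_sum_le_sum_abs _ _).trans ?_
  simpa using Finset.sum_le_card_nsmul (Finset.range n) _ M fun i _ => hM (f^[i] x)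

theorem exists_forall_abs_le_of_continuous {X : Type*} [TopologicalSpace X] [CompactSpace X]
    {φ : X → ℝ} (hφ : Continuous φ) : ∃ M, 0 ≤ M ∧ ∀ x, |φ x| ≤ M := by
  obtain ⟨M, hM⟩ := isCompact_univ.exists_bound_of_continuousOn hφ.continuousOn
  exact ⟨max M 0, le_max_right _ _, fun x => (hM x trivial).trans (le_max_left _ _)⟩

/-- If every orbit has a positive Birkhoff sum at some positive time, then all Birkhoff sums
are uniformly bounded below. -/
theorem exists_forall_le_birkhoffSum {X : Type*} [TopologicalSpace X] [CompactSpace X]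
    {f : X → X} (hf : Continuous f) {φ : X → ℝ} (hφ : Continuous φ)
    (h : ∀ y, ∃ n, 0 < birkhoffSum f φ (n + 1) y) :
    ∃ K, ∀ n y, K ≤ birkhoffSum f φ n y := by
  obtain ⟨M, hM0, hM⟩ := exists_forall_abs_le_of_continuous hφ
  obtain ⟨t, ht⟩ := isCompact_univ.elim_finite_subcover
    (fun n => {y | 0 < birkhoffSum f φ (n + 1) y})
    (fun n => isOpen_lt continuous_const (continuous_birkhoffSum hf hφ (n + 1)))
    (fun y _ => Set.mem_iUnion.2 (h y))
  set N := t.sup id + 1 with hN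
  refine ⟨-(N * M), fun n => ?_⟩
  induction n using Nat.strong_induction_on with
  | _ n ih =>
    intro y
    rcases le_or_gt n N with hn | hn
    · have h1 := (abs_le.1 (abs_birkhoffSum_le f hM n y)).1
      have h2 : (n : ℝ) * M ≤ N * M := by gcongr
      linarith
    · obtain ⟨m, hmt, hm⟩ := Set.mem_iUnion₂.1 (ht (Set.mem_univ y))
      have hmN : m ≤ t.sup id := Finset.le_sup (f := id) hmt
      have hsplit := birkhoffSum_add f φ (m + 1) (n - (m + 1)) y
      rw [Nat.add_sub_cancel' (by omega)] at hsplit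
      have := ih (n - (m + 1)) (by omega) (f^[m + 1] y)
      rw [Set.mem_ofPred_eq] at hm
      linarith

theorem birkhoffSum_sub_const {X : Type*} (f : X → X) (φ : X → ℝ) (c : ℝ) (n : ℕ) (x : X) :
    birkhoffSum f (fun y => φ y - c) n x = birkhoffSum f φ n x - n * c := by
  simp [birkhoffSum, Finset.sum_sub_distrib]

/-- If some point of a compact metric space has a negative `liminf` of Birkhoff averages of a
continuous function `φ` along the orbit of a continuous map `f`, then some point has a
negative `limsup` of these Birkhoff averages. -/
theorem exists_point_limsup_neg_of_liminf_neg
    {X : Type*} [MetricSpace X] [CompactSpace X]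
    (f : X → X) (hf : Continuous f) (φ : X → ℝ) (hφ : Continuous φ)
    (x : X)
    (hx : Filter.liminf
        (fun n : ℕ => (1 / (n : ℝ)) * ∑ i ∈ Finset.range n, φ (f^[i] x)) atTop < 0) :
    ∃ y : X, Filter.limsup
        (fun n : ℕ => (1 / (n : ℝ)) * ∑ i ∈ Finset.range n, φ (f^[i] y)) atTop < 0 := by
  change liminf (fun n : ℕ => (1 / (n : ℝ)) * birkhoffSum f φ n x) atTop < 0 at hx
  change ∃ y, limsup (fun n : ℕ => (1 / (n : ℝ)) * birkhoffSum f φ n y) atTop < 0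
  obtain ⟨M, hM0, hM⟩ := exists_forall_abs_le_of_continuous hφ
  have hbound (n : ℕ) (y : X) : |1 / (n : ℝ) * birkhoffSum f φ n y| ≤ M := by
    rw [abs_mul, abs_of_nonneg (by positivity), one_div_mul_eq_div]
    exact div_le_of_le_mul₀ (by positivity) hM0
      ((abs_birkhoffSum_le f hM n y).trans_eq (mul_comm _ _))
  obtain ⟨c, hc, hc0⟩ := exists_between hx
  obtain ⟨b, hb, hbc⟩ := exists_between hc
  by_cases h : ∃ y, ∀ n, birkhoffSum f (fun z => φ z - c) (n + 1) y ≤ 0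
  · obtain ⟨y, hy⟩ := h
    refine ⟨y, lt_of_le_of_lt (limsup_le_of_le ?_ ?_) hc0⟩
    · exact IsBoundedUnder.isCoboundedUnder_le
        ⟨-M, eventually_map.2 (.of_forall fun n => (abs_le.1 (hbound n y)).1)⟩
    · filter_upwards [eventually_gt_atTop 0] with n hn
      obtain ⟨k, rfl⟩ := Nat.exists_eq_succ_of_ne_zero hn.ne'
      have hk := hy k
      rw [birkhoffSum_sub_const] at hk
      rw [one_div_mul_eq_div, div_le_iff₀ (by positivity)]
      simp only [Nat.succ_eq_add_one]
      linarith
  · push Not at h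
    obtain ⟨K, hK⟩ := exists_forall_le_birkhoffSum (φ := fun z => φ z - c) hf (by fun_prop) h
    have hfreq : ∃ᶠ n : ℕ in atTop, 1 / (n : ℝ) * birkhoffSum f φ n x < b :=
      frequently_lt_of_liminf_lt (IsBoundedUnder.isCoboundedUnder_ge
        ⟨M, eventually_map.2 (.of_forall fun n => (abs_le.1 (hbound n x)).2)⟩) hb
    have hlarge : ∀ᶠ n : ℕ in atTop, -K / (c - b) < n :=
      tendsto_natCast_atTop_atTop.eventually_gt_atTop _
    obtain ⟨n, hnb, hn, hn0⟩ :=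
      (hfreq.and_eventually (hlarge.and (eventually_gt_atTop 0))).exists
    have hn0' : (0 : ℝ) < n := by exact_mod_cast hn0
    rw [one_div_mul_eq_div, div_lt_iff₀ hn0'] at hnb
    rw [div_lt_iff₀ (sub_pos.2 hbc)] at hn
    have hKn := hK n x
    rw [birkhoffSum_sub_const] at hKn
    linarith
end

section
/- Let X be a compact metric space, f : X → X a continuous map, and φ : X → ℝ a continuous function. If there exists a point x ∈ X such that limsup_{n→∞} (1/n)·∑_{i=0}^{n−1} φ(f^i(x)) > 0, then there exists a point y ∈ X such that liminf_{n→∞} (1/n)·∑_{i=0}^{n−1} φ(f^i(y)) > 0. -/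
open Filter

/-- If every point of a compact space has a positive time `n` at which its Birkhoff sum is less
than `c * n`, then all Birkhoff sums satisfy `birkhoffSum f φ m x ≤ c * m + K` for a uniform
constant `K`. -/
theorem exists_birkhoffSum_le_mul_add {X : Type*} [TopologicalSpace X] [CompactSpace X]
    {f : X → X} (hf : Continuous f) {φ : X → ℝ} (hφ : Continuous φ) {c : ℝ} (hc : 0 ≤ c)
    (h : ∀ y, ∃ n : ℕ, 0 < n ∧ birkhoffSum f φ n y < c * n) :
    ∃ K : ℝ, ∀ (m : ℕ) (y : X), birkhoffSum f φ m y ≤ c * m + K := by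
  have hcont (n : ℕ) : Continuous (birkhoffSum f φ n) :=
    continuous_finsetSum _ fun i _ => hφ.comp (hf.iterate i)
  choose n hn hlt using h
  obtain ⟨t, ht⟩ := isCompact_univ.elim_finite_subcover
    (fun y => {z | birkhoffSum f φ (n y) z < c * n y})
    (fun y => isOpen_lt (hcont _) continuous_const)
    (fun y _ => Set.mem_iUnion.2 ⟨y, hlt y⟩)
  obtain ⟨C, hC⟩ := isCompact_univ.exists_bound_of_continuousOn hφ.continuousOn
  set N := t.sup n
  refine ⟨N * |C|, fun m => ?_⟩
  induction m using Nat.strong_induction_on with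
  | _ m ih =>
    intro y
    rcases lt_or_ge m N with hm | hm
    · have hsum : birkhoffSum f φ m y ≤ m * |C| := by
        refine (Finset.sum_le_card_nsmul _ _ |C| fun i _ => ?_).trans_eq (by simp)
        exact (le_abs_self _).trans ((hC _ (Set.mem_univ _)).trans (le_abs_self C))
      have hle : (m : ℝ) * |C| ≤ N * |C| := by gcongr
      have : 0 ≤ c * m := by positivity
      linarith
    · obtain ⟨z, hz, hy⟩ := Set.mem_iUnion₂.1 (ht (Set.mem_univ y))
      have hy : birkhoffSum f φ (n z) y < c * n z := hy
      obtain ⟨k, rfl⟩ := Nat.exists_eq_add_of_le ((Finset.le_sup (f := n) hz).trans hm)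
      rw [birkhoffSum_add]
      have hk := ih k (by have := hn z; omega) (f^[n z] y)
      push_cast
      linarith

/-- Birkhoff averages of a bounded function are bounded. -/
theorem abs_inv_mul_birkhoffSum_le {X : Type*} {f : X → X} {φ : X → ℝ} {C : ℝ}
    (hC : ∀ x, |φ x| ≤ C) (n : ℕ) (x : X) : |1 / (n : ℝ) * birkhoffSum f φ n x| ≤ C := by
  have hC0 : 0 ≤ C := (abs_nonneg _).trans (hC x)
  rcases n.eq_zero_or_pos with rfl | hn
  · simpa using hC0
  · have hn' : (0 : ℝ) < n := by exact_mod_cast hn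
    have hsum : |birkhoffSum f φ n x| ≤ n * C :=
      (Finset.abs_sum_le_sum_abs _ _).trans
        ((Finset.sum_le_card_nsmul _ _ C fun i _ => hC _).trans_eq (by simp))
    rw [abs_mul, abs_of_pos (by positivity), one_div_mul_eq_div, div_le_iff₀ hn']
    linarith

/-- If some point of a compact metric space has a positive `limsup` of Birkhoff averages of a
continuous function `φ` along the orbit of a continuous map `f`, then some point has a
positive `liminf` of these Birkhoff averages. -/
theorem exists_point_liminf_pos_of_limsup_pos
    {X : Type*} [MetricSpace X] [CompactSpace X]
    (f : X → X) (hf : Continuous f) (φ : X → ℝ) (hφ : Continuous φ)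
    (x : X)
    (hx : 0 < Filter.limsup
        (fun n : ℕ => (1 / (n : ℝ)) * ∑ i ∈ Finset.range n, φ (f^[i] x)) atTop) :
    ∃ y : X, 0 < Filter.liminf
        (fun n : ℕ => (1 / (n : ℝ)) * ∑ i ∈ Finset.range n, φ (f^[i] y)) atTop := by
  by_contra! hy
  change 0 < limsup (fun n : ℕ => 1 / (n : ℝ) * birkhoffSum f φ n x) atTop at hx
  obtain ⟨C, hC⟩ := isCompact_univ.exists_bound_of_continuousOn hφ.continuousOn
  have hbound (n : ℕ) (y : X) := abs_le.1 <|
    abs_inv_mul_birkhoffSum_le (f := f) (fun z => hC z (Set.mem_univ z)) n y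
  obtain ⟨c, hc, hcx⟩ := exists_between (half_pos hx)
  obtain ⟨K, hK⟩ := exists_birkhoffSum_le_mul_add hf hφ hc.le fun y => by
    have hfreq := frequently_lt_of_liminf_lt
      (isBoundedUnder_of ⟨C, fun n => (hbound n y).2⟩ :
        IsBoundedUnder (· ≤ ·) atTop _).isCoboundedUnder_ge ((hy y).trans_lt hc)
    obtain ⟨n, hlt, hn⟩ := (hfreq.and_eventually (eventually_gt_atTop 0)).exists
    refine ⟨n, hn, ?_⟩
    rwa [one_div_mul_eq_div, div_lt_iff₀ (by exact_mod_cast hn)] at hlt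
  have hfreq := frequently_lt_of_lt_limsup
    (isBoundedUnder_of ⟨-C, fun n => (hbound n x).1⟩ :
      IsBoundedUnder (· ≥ ·) atTop _).isCoboundedUnder_le (show 2 * c < _ by linarith)
  have hsmall := (tendsto_const_div_atTop_nhds_zero_nat K).eventually_lt_const hc
  obtain ⟨n, hlt, hn, hKn⟩ :=
    (hfreq.and_eventually ((eventually_gt_atTop 0).and hsmall)).exists
  have hn' : (0 : ℝ) < n := by exact_mod_cast hn
  rw [one_div_mul_eq_div, lt_div_iff₀ hn'] at hlt
  rw [div_lt_iff₀ hn'] at hKn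
  linarith [hK n x]
end

section
/- Let (a_i)_{i≥0} be a sequence of real numbers with |a_i| ≤ K for all i, for some K > 0. If limsup_{n→∞} (1/n)·∑_{i=0}^{n−1} a_i > 0, then there exist a constant c > 0 and a strictly increasing sequence of positive integers n₁ < n₂ < … such that for every j ≥ 1 and every 1 ≤ k ≤ n_j one has ∑_{i=n_j−k}^{n_j−1} a_i > c·k. -/
open Filter

/-- A real sequence that is unbounded above exceeds all of its earlier values at infinitely
many times. -/
lemma frequently_strict_record {S : ℕ → ℝ} (hS : ∀ M, ∃ n, M < S n) :
    ∃ᶠ n in atTop, ∀ m < n, S m < S n := by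
  classical
  rw [frequently_atTop']
  intro N
  obtain ⟨M, hM⟩ := ((Finset.range (N + 1)).image S).bddAbove
  have hle : ∀ m ≤ N, S m ≤ M := fun m hm =>
    hM (Finset.mem_coe.2 (Finset.mem_image_of_mem S (Finset.mem_range_succ_iff.2 hm)))
  refine ⟨Nat.find (hS M), ?_, fun m hm => ?_⟩
  · by_contra! hn
    exact (hle _ hn).not_gt (Nat.find_spec (hS M))
  · exact (not_lt.1 (Nat.find_min (hS M) hm)).trans_lt (Nat.find_spec (hS M))

/-- The averages of a sequence bounded by `K` are bounded below by `-K`. -/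
lemma neg_le_average_of_abs_le {K : ℝ} {a : ℕ → ℝ} (ha : ∀ i, |a i| ≤ K) (n : ℕ) :
    -K ≤ (1 / (n : ℝ)) * ∑ i ∈ Finset.range n, a i := by
  rcases n.eq_zero_or_pos with rfl | hn
  · simpa using (abs_nonneg _).trans (ha 0)
  · have hsum := Finset.card_nsmul_le_sum (Finset.range n) a (-K)
      fun i _ => (abs_le.1 (ha i)).1
    rw [Finset.card_range, nsmul_eq_mul] at hsum
    rw [one_div_mul_eq_div, le_div_iff₀ (by positivity)]
    linarith

/-- If the averages of `a` frequently exceed `d > c`, the sums of `a - c` are unbounded above. -/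
lemma exists_lt_sum_sub_of_frequently_lt_average {a : ℕ → ℝ} {c d : ℝ} (hcd : c < d)
    (h : ∃ᶠ n : ℕ in atTop, d < (1 / (n : ℝ)) * ∑ i ∈ Finset.range n, a i) (M : ℝ) :
    ∃ n : ℕ, M < ∑ i ∈ Finset.range n, a i - c * n := by
  obtain ⟨n, hn, hn0, hnM⟩ := (h.and_eventually ((eventually_gt_atTop 0).and
    (tendsto_natCast_atTop_atTop.eventually_gt_atTop (M / (d - c))))).exists
  have hpos : (0 : ℝ) < n := by exact_mod_cast hn0
  rw [one_div_mul_eq_div, lt_div_iff₀ hpos] at hn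
  rw [div_lt_iff₀ (sub_pos.2 hcd)] at hnM
  exact ⟨n, by linarith⟩

/-- Pliss-type lemma for infinite bounded sequences: if a bounded sequence of reals has
positive `limsup` of its averages, then there are a constant `c > 0` and infinitely many
times `n₁ < n₂ < …` (all positive) such that every backward sum from each `n_j` grows at
the uniform linear rate `c·k`. -/
theorem exists_hyperbolic_times_of_limsup_pos
    (K : ℝ) (hK : 0 < K) (a : ℕ → ℝ) (ha : ∀ i, |a i| ≤ K)
    (h : 0 < Filter.limsup
        (fun n : ℕ => (1 / (n : ℝ)) * ∑ i ∈ Finset.range n, a i) atTop) :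
    ∃ c : ℝ, 0 < c ∧ ∃ ns : ℕ → ℕ, StrictMono ns ∧ (∀ j, 1 ≤ ns j) ∧
      ∀ j, ∀ k, 1 ≤ k → k ≤ ns j →
        c * (k : ℝ) < ∑ i ∈ Finset.Ico (ns j - k) (ns j), a i := by
  obtain ⟨d, hd, hdL⟩ := exists_between h
  obtain ⟨c, hc, hcd⟩ := exists_between hd
  have hcob : IsCoboundedUnder (· ≤ ·) atTop
      (fun n : ℕ => (1 / (n : ℝ)) * ∑ i ∈ Finset.range n, a i) :=
    (isBoundedUnder_of ⟨-K, neg_le_average_of_abs_le ha⟩ :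
      IsBoundedUnder (· ≥ ·) atTop _).isCoboundedUnder_le
  have hrec := frequently_strict_record
    (exists_lt_sum_sub_of_frequently_lt_average hcd (frequently_lt_of_lt_limsup hcob hdL))
  obtain ⟨ns, hmono, hns⟩ :=
    extraction_of_frequently_atTop (hrec.and_eventually (eventually_ge_atTop 1))
  refine ⟨c, hc, ns, hmono, fun j => (hns j).2, fun j k hk hkn => ?_⟩
  have hlt := (hns j).1 (ns j - k) (by omega)
  rw [Finset.sum_Ico_eq_sub _ (Nat.sub_le _ _)]
  push_cast [hkn] at hlt
  linarith
end

section
/- Let N ≥ 1 be an integer, let c be a real number, and let (a_i)_{i≥0} be an N-periodic sequence of real numbers (i.e. a_{i+N} = a_i for all i ≥ 0) such that ∑_{i=0}^{N−1} a_i < N·c. Then there exists an index 0 ≤ r < N such that for every k ≥ 1 one has ∑_{i=r}^{r+k−1} a_i < k·c. -/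
/-- A real sequence that strictly decreases under translation by `N ≥ 1` has an index `r < N`
at which it is strictly larger than at every later index. -/
theorem exists_lt_forall_gt_lt_of_add_lt {N : ℕ} (hN : 1 ≤ N) {S : ℕ → ℝ}
    (hS : ∀ n, S (n + N) < S n) : ∃ r < N, ∀ m, r < m → S m < S r := by
  obtain ⟨r, hr, hmax⟩ := Finset.exists_max_image (Finset.range N)
    (fun n => toLex (S n, n)) ⟨0, Finset.mem_range.2 hN⟩
  simp only [Finset.mem_range, Prod.Lex.toLex_le_toLex] at hr hmax
  refine ⟨r, hr, fun m => ?_⟩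
  induction m using Nat.strong_induction_on with
  | _ m ih =>
    intro hm
    rcases lt_or_ge m N with h | h
    · rcases hmax m h with h1 | ⟨-, h1⟩
      · exact h1
      · omega
    · obtain ⟨j, rfl⟩ := Nat.exists_eq_add_of_le' h
      refine (hS j).trans_le ?_
      rcases lt_or_ge r j with hj | hj
      · exact (ih j (by omega) hj).le
      · rcases hmax j (by omega) with h1 | ⟨h1, -⟩
        · exact h1.le
        · exact h1.le

/-- If an `N`-periodic sequence of reals has average over one period strictly below `c`,
then some phase `0 ≤ r < N` has all of its forward partial sums (of every length `k ≥ 1`)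
strictly below `k·c`. -/
theorem periodic_pliss (N : ℕ) (hN : 1 ≤ N) (c : ℝ) (a : ℕ → ℝ)
    (hper : ∀ i, a (i + N) = a i)
    (hsum : ∑ i ∈ Finset.range N, a i < (N : ℝ) * c) :
    ∃ r : ℕ, r < N ∧ ∀ k : ℕ, 1 ≤ k →
      ∑ i ∈ Finset.Ico r (r + k), a i < (k : ℝ) * c := by
  have hS : ∀ n : ℕ, ∑ i ∈ Finset.range (n + N), a i - ((n + N : ℕ) : ℝ) * c <
      ∑ i ∈ Finset.range n, a i - (n : ℝ) * c := by
    intro n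
    rw [add_comm n N, Finset.sum_range_add]
    simp only [add_comm N, hper]
    push_cast
    linarith
  obtain ⟨r, hr, h⟩ := exists_lt_forall_gt_lt_of_add_lt hN
    (S := fun n => ∑ i ∈ Finset.range n, a i - (n : ℝ) * c) hS
  refine ⟨r, hr, fun k hk => ?_⟩
  have hlt := h (r + k) (by omega)
  rw [Finset.sum_Ico_eq_sub _ (Nat.le_add_right r k)]
  push_cast at hlt
  linarith
end

section
/- Let X be a compact metric space and f : X → X a homeomorphism. For each integer m ≥ 1 let ψ_m : X → ℝ be a continuous function, and assume the subadditive cocycle property ψ_{m+n}(x) ≤ ψ_m(x) + ψ_n(f^m(x)) for all m, n ≥ 1 and all x ∈ X. Call a nonempty compact f-invariant set K ⊆ X contracting if there exists m ≥ 1 with ψ_m(x) < 0 for all x ∈ K. Then every nonempty compact f-invariant set Λ ⊆ X that is not contracting contains a nonempty compact f-invariant subset K ⊆ Λ that is not contracting and is minimal with this property, i.e., every nonempty compact f-invariant proper subset K' ⊊ K is contracting. -/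
/-- A nonempty compact invariant set `K` is *contracting* for the family `ψ` if for some
`m ≥ 1` the function `ψ m` is negative on all of `K`. -/
def IsContracting {X : Type*} [MetricSpace X] (ψ : ℕ → X → ℝ) (K : Set X) : Prop :=
  ∃ m : ℕ, 1 ≤ m ∧ ∀ x ∈ K, ψ m x < 0

theorem isContracting_empty {X : Type*} [MetricSpace X] (ψ : ℕ → X → ℝ) :
    IsContracting ψ ∅ :=
  ⟨1, le_rfl, fun _ hx => hx.elim⟩

/-- If the intersection of a nonempty chain of compact sets is contracting, then so is some
member of the chain. -/
theorem exists_isContracting_of_isContracting_sInter {X : Type*} [MetricSpace X]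
    {ψ : ℕ → X → ℝ} (hcont : ∀ m : ℕ, 1 ≤ m → Continuous (ψ m)) {c : Set (Set X)}
    (hc : IsChain (· ⊆ ·) c) (hne : c.Nonempty) (hcpt : ∀ s ∈ c, IsCompact s)
    (h : IsContracting ψ (⋂₀ c)) : ∃ s ∈ c, IsContracting ψ s := by
  obtain ⟨m, hm, hneg⟩ := h
  have : Nonempty c := hne.to_subtype
  have hopen : IsOpen {x | ψ m x < 0} := isOpen_lt (hcont m hm) continuous_const
  have hdir : Directed (· ⊇ ·) (fun s : c => (s : Set X)) :=
    DirectedOn.directed_val (IsChain.directedOn hc.symm)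
  obtain ⟨s, hs⟩ := exists_subset_nhds_of_isCompact hdir (fun s => hcpt s s.2)
    (U := {x | ψ m x < 0}) (fun x hx =>
      hopen.mem_nhds (hneg x (by rwa [Set.sInter_eq_iInter])))
  exact ⟨s, s.2, m, hm, hs⟩

/-- Existence of minimally non-contracting subsets: for a subadditive cocycle `ψ` over a
homeomorphism `f` of a compact metric space, every nonempty compact invariant
non-contracting set `Λ` contains a nonempty compact invariant non-contracting subset `K`
all of whose nonempty compact invariant proper subsets are contracting. -/
theorem exists_minimally_non_contracting
    {X : Type*} [MetricSpace X] [CompactSpace X] (f : X ≃ₜ X)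
    (ψ : ℕ → X → ℝ) (hcont : ∀ m : ℕ, 1 ≤ m → Continuous (ψ m))
    (hsub : ∀ m n : ℕ, 1 ≤ m → 1 ≤ n → ∀ x : X,
      ψ (m + n) x ≤ ψ m x + ψ n ((⇑f)^[m] x))
    (Λ : Set X) (hne : Λ.Nonempty) (hΛ : IsCompact Λ) (hfΛ : (⇑f) '' Λ = Λ)
    (hnc : ¬ IsContracting ψ Λ) :
    ∃ K ⊆ Λ, K.Nonempty ∧ IsCompact K ∧ (⇑f) '' K = K ∧ ¬ IsContracting ψ K ∧
      ∀ K' : Set X, K' ⊂ K → K'.Nonempty → IsCompact K' → (⇑f) '' K' = K' →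
        IsContracting ψ K' := by
  obtain ⟨K, hKΛ, ⟨hK, hfK, hKnc⟩, hmin⟩ := zorn_superset_nonempty
    {K : Set X | IsCompact K ∧ (⇑f) '' K = K ∧ ¬ IsContracting ψ K}
    (fun c hcS hc hcne => by
      refine ⟨⋂₀ c, ⟨?_, ?_, fun h => ?_⟩, fun s hs => Set.sInter_subset_of_mem hs⟩
      · exact (isClosed_sInter fun s hs => (hcS hs).1.isClosed).isCompact
      · rw [Set.sInter_eq_biInter, Set.image_iInter₂ f.bijective]
        exact Set.iInter₂_congr fun s hs => (hcS hs).2.1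
      · obtain ⟨s, hs, hsc⟩ := exists_isContracting_of_isContracting_sInter hcont hc hcne
          (fun s hs => (hcS hs).1) h
        exact (hcS hs).2.2 hsc)
    Λ ⟨hΛ, hfΛ, hnc⟩
  refine ⟨K, hKΛ, ?_, hK, hfK, hKnc, fun K' hK'K _ hK' hfK' => ?_⟩
  · rw [Set.nonempty_iff_ne_empty]
    rintro rfl
    exact hKnc (isContracting_empty ψ)
  · by_contra hK'nc
    exact hK'K.not_subset (hmin ⟨hK', hfK', hK'nc⟩ hK'K.subset)
end
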